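/- arXiv:2409.04032 — 2 statements merged into one kernel-verified Lean document; each statement's English description precedes it below -/
import Mathlib

section
/- The polynomials P₁ and P₂ have no common nonconstant divisor in ℂ[x,y]: every polynomial g ∈ ℂ[x,y] dividing both P₁ and P₂ is a nonzero constant. (Geometrically, the red quintic and the blue quintic of the double star arrangement share no common line.) -/
open MvPolynomial

/-- The quintic `P₁` regarded as an element of `ℂ[x,y]`. -/
noncomputable def P₁ : MvPolynomial (Fin 2) ℂ :=
  C (2/5) * X 0 ^ 5 - C 4 * X 0 ^ 3 * X 1 ^ 2 + C 2 * X 0 * X 1 ^ 4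
    + C ((1 + (Real.sqrt 5 : ℂ))/2) * X 0 ^ 4 + C (1 + (Real.sqrt 5 : ℂ)) * X 0 ^ 2 * X 1 ^ 2
    + C ((1 + (Real.sqrt 5 : ℂ))/2) * X 1 ^ 4
    - C (2 + (Real.sqrt 5 : ℂ)) * X 0 ^ 2 - C (2 + (Real.sqrt 5 : ℂ)) * X 1 ^ 2
    + C ((11 + 5 * (Real.sqrt 5 : ℂ))/10)

/-- The quintic `P₂` regarded as an element of `ℂ[x,y]`. -/
noncomputable def P₂ : MvPolynomial (Fin 2) ℂ :=
  C (2/5) * X 0 ^ 5 - C 4 * X 0 ^ 3 * X 1 ^ 2 + C 2 * X 0 * X 1 ^ 4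
    + C ((1 - (Real.sqrt 5 : ℂ))/2) * X 0 ^ 4 + C (1 - (Real.sqrt 5 : ℂ)) * X 0 ^ 2 * X 1 ^ 2
    + C ((1 - (Real.sqrt 5 : ℂ))/2) * X 1 ^ 4
    - C (2 - (Real.sqrt 5 : ℂ)) * X 0 ^ 2 - C (2 - (Real.sqrt 5 : ℂ)) * X 1 ^ 2
    + C ((11 - 5 * (Real.sqrt 5 : ℂ))/10)

/-- A polynomial in the single variable `X i` does not involve any other variable. -/
lemma degreeOf_aeval_X_of_ne {R σ : Type*} [CommSemiring R] {i j : σ} (hij : i ≠ j)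
    (p : Polynomial R) :
    degreeOf j (Polynomial.aeval (X i : MvPolynomial σ R) p) = 0 := by
  have hsupp : Polynomial.aeval (X i : MvPolynomial σ R) p ∈ supported R {i} := by
    rw [supported, Set.image_singleton]
    exact Polynomial.aeval_mem_adjoin_singleton R _
  by_contra hj
  exact hij (mem_supported.1 hsupp (mem_vars_iff_degreeOf_ne_zero.2 hj)).symm

/-- A divisor of a nonzero polynomial in `X i` does not involve any other variable. -/
lemma degreeOf_eq_zero_of_dvd_aeval_X {R σ : Type*} [CommRing R] [IsDomain R] {i j : σ}
    (hij : i ≠ j) {p : Polynomial R} (hp : p ≠ 0) {g : MvPolynomial σ R}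
    (hg : g ∣ Polynomial.aeval (X i) p) : degreeOf j g = 0 := by
  obtain ⟨k, hk⟩ := hg
  have hne : g * k ≠ 0 := by
    rw [← hk]
    exact fun h => hp ((transcendental_iff.1 (transcendental_X R i)) p h)
  have hdeg := degreeOf_aeval_X_of_ne hij p
  rw [hk, degreeOf_mul_eq (left_ne_zero_of_mul hne) (right_ne_zero_of_mul hne)] at hdeg
  omega

/-- A common divisor of a nonzero polynomial in `X 0` and one in `X 1` is a unit. -/
lemma isUnit_of_dvd_aeval_X {K : Type*} [Field K] {p q : Polynomial K} (hp : p ≠ 0) (hq : q ≠ 0)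
    {g : MvPolynomial (Fin 2) K} (hgp : g ∣ Polynomial.aeval (X 0) p)
    (hgq : g ∣ Polynomial.aeval (X 1) q) : IsUnit g := by
  have h1 : degreeOf 1 g = 0 := degreeOf_eq_zero_of_dvd_aeval_X (by decide) hp hgp
  have h0 : degreeOf 0 g = 0 := degreeOf_eq_zero_of_dvd_aeval_X (by decide) hq hgq
  have hg : g ≠ 0 := by
    rintro rfl
    exact hp ((transcendental_iff.1 (transcendental_X K (0 : Fin 2))) p (zero_dvd_iff.1 hgp))
  have hvars : g.vars = ∅ := by
    refine Finset.eq_empty_of_forall_notMem fun i hi => mem_vars_iff_degreeOf_ne_zero.1 hi ?_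
    fin_cases i
    · exact h0
    · exact h1
  rw [vars_eq_empty_iff_eq_C.1 hvars] at hg ⊢
  exact (isUnit_iff_ne_zero.2 fun h => hg (by rw [h, C_0])).map C

lemma P₁_sub_P₂ : P₁ - P₂ = C (Real.sqrt 5 : ℂ) * (X 0 ^ 2 + X 1 ^ 2 - 1) ^ 2 := by
  refine MvPolynomial.funext fun v => ?_
  simp only [P₁, P₂, map_add, map_sub, map_mul, map_pow, eval_C, eval_X, map_one]
  ring

/-- Modulo the unit circle, `P₁ + P₂` is a multiple of `T₅(x) - 1`, with `T₅` the fifth Chebyshev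
polynomial. -/
lemma P₁_add_P₂ :
    C (5 / 4) * (P₁ + P₂) = 16 * X 0 ^ 5 - 20 * X 0 ^ 3 + 5 * X 0 - 1
      + (X 0 ^ 2 + X 1 ^ 2 - 1) * (10 * X 0 - 20 * X 0 ^ 3 - C (5 / 2))
      + (X 0 ^ 2 + X 1 ^ 2 - 1) ^ 2 * (5 * X 0 + C (5 / 4)) := by
  refine MvPolynomial.funext fun v => ?_
  simp only [P₁, P₂, map_add, map_sub, map_mul, map_pow, eval_C, eval_X, map_one, map_ofNat]
  ring

/-- On the circle `x² + y² = 1` one has `T₅(x)² + T₅(y)² = 1`, with `T₅` the fifth Chebyshev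
polynomial. -/
lemma circle_dvd_chebyshev_sq_add_sq {R : Type*} [CommRing R] (x y : R) :
    x ^ 2 + y ^ 2 - 1 ∣
      (16 * x ^ 5 - 20 * x ^ 3 + 5 * x) ^ 2 + (16 * y ^ 5 - 20 * y ^ 3 + 5 * y) ^ 2 - 1 := by
  have h := Polynomial.sub_dvd_eval_sub (x ^ 2) (1 - y ^ 2)
    (Polynomial.X * (16 * Polynomial.X ^ 2 - 20 * Polynomial.X + 5) ^ 2)
  simp only [Polynomial.eval_mul, Polynomial.eval_X, Polynomial.eval_pow, Polynomial.eval_add,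
    Polynomial.eval_sub, Polynomial.eval_ofNat] at h
  convert h using 1 <;> ring

/-- `P₁` and `P₂` have no common nonconstant divisor in `ℂ[x,y]`: any common divisor is a
unit, i.e. a nonzero constant. -/
theorem P1_P2_coprime :
    ∀ g : MvPolynomial (Fin 2) ℂ, g ∣ P₁ → g ∣ P₂ → IsUnit g := by
  intro g h₁ h₂
  have hcirc : g ∣ (X 0 ^ 2 + X 1 ^ 2 - 1) ^ 2 := by
    have hunit : IsUnit (C (Real.sqrt 5 : ℂ) : MvPolynomial (Fin 2) ℂ) :=
      (isUnit_iff_ne_zero.2 (by simp)).map C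
    rw [← hunit.dvd_mul_left, ← P₁_sub_P₂]
    exact dvd_sub h₁ h₂
  have hx : g ∣ (16 * X 0 ^ 5 - 20 * X 0 ^ 3 + 5 * X 0 - 1) ^ 2 := by
    obtain ⟨a, ha⟩ := (dvd_add h₁ h₂).mul_left (C (5 / 4))
    obtain ⟨b, hb⟩ := hcirc
    rw [P₁_add_P₂] at ha
    set t : MvPolynomial (Fin 2) ℂ := 16 * X 0 ^ 5 - 20 * X 0 ^ 3 + 5 * X 0 - 1
    set q : MvPolynomial (Fin 2) ℂ := X 0 ^ 2 + X 1 ^ 2 - 1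
    set m : MvPolynomial (Fin 2) ℂ := 10 * X 0 - 20 * X 0 ^ 3 - C (5 / 2)
    set n : MvPolynomial (Fin 2) ℂ := 5 * X 0 + C (5 / 4)
    exact ⟨(a - b * n) * (t - q * m) + b * m ^ 2,
      by linear_combination (t - q * m) * ha + (m ^ 2 - n * (t - q * m)) * hb⟩
  have hy : g ∣ (16 * X 1 ^ 5 - 20 * X 1 ^ 3 + 5 * X 1) ^ 6 := by
    obtain ⟨w, hw⟩ := circle_dvd_chebyshev_sq_add_sq (X 0 : MvPolynomial (Fin 2) ℂ) (X 1)
    obtain ⟨a, ha⟩ := hx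
    obtain ⟨b, hb⟩ := hcirc
    set q : MvPolynomial (Fin 2) ℂ := X 0 ^ 2 + X 1 ^ 2 - 1
    set t : MvPolynomial (Fin 2) ℂ := 16 * X 0 ^ 5 - 20 * X 0 ^ 3 + 5 * X 0 - 1 with ht
    set u : MvPolynomial (Fin 2) ℂ := 16 * X 1 ^ 5 - 20 * X 1 ^ 3 + 5 * X 1
    have hu : u ^ 2 = q * w - t * (t + 2) := by
      rw [ht]
      linear_combination hw
    have hcube : u ^ 6 = (q * w - t * (t + 2)) ^ 3 := by
      rw [← hu]
      ring
    rw [hcube]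
    exact ⟨b * (q * w ^ 3 - 3 * w ^ 2 * (t * (t + 2)))
        + a * (3 * q * w * (t + 2) ^ 2 - t * (t + 2) ^ 3), by
      linear_combination (q * w ^ 3 - 3 * w ^ 2 * (t * (t + 2))) * hb
        + (3 * q * w * (t + 2) ^ 2 - t * (t + 2) ^ 3) * ha⟩
  refine isUnit_of_dvd_aeval_X
    (p := (16 * Polynomial.X ^ 5 - 20 * Polynomial.X ^ 3 + 5 * Polynomial.X - 1) ^ 2)
    (q := (16 * Polynomial.X ^ 5 - 20 * Polynomial.X ^ 3 + 5 * Polynomial.X) ^ 6)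
    (fun h => ?_) (fun h => ?_) ?_ ?_
  · simpa using congrArg (Polynomial.eval 0) h
  · have h1 := congrArg (Polynomial.eval 1) h
    norm_num at h1
  · simp only [map_pow, map_sub, map_add, map_mul, map_one, map_ofNat, Polynomial.aeval_X]
    exact hx
  · simp only [map_pow, map_sub, map_add, map_mul, map_ofNat, Polynomial.aeval_X]
    exact hy
end

section
/- For every complex number λ with λ ≠ 0 and λ ≠ 1, the polynomial P₁ − λ·P₂ ∈ ℂ[x,y] is not a d-th power up to a constant for any integer d ≥ 2: there is no g ∈ ℂ[x,y] and constant u ∈ ℂ* with P₁ − λ·P₂ = u·g^d and d ≥ 2. Equivalently, the gcd of the multiplicities of the irreducible factors of P₁ − λ·P₂ equals 1. (Hence the orbifold fibration h = P₁/P₂ has no multiple fiber over any λ ∈ ℂ* \ {1}.) -/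
open MvPolynomial

/-- The exponent of a power in `ℂ[x,y]` divides the degree of its image in `ℂ[t]` under any
specialization of the variables. -/
theorem dvd_natDegree_aeval_of_eq_C_mul_pow {F g : MvPolynomial (Fin 2) ℂ} {u : ℂ} {d : ℕ}
    (hu : u ≠ 0) (h : F = C u * g ^ d) (v : Fin 2 → Polynomial ℂ) :
    d ∣ (aeval v F).natDegree := by
  have hC : aeval v F = Polynomial.C u * aeval v g ^ d := by
    rw [h, map_mul, map_pow, aeval_C, Polynomial.algebraMap_eq]
  rw [hC, Polynomial.natDegree_C_mul hu, Polynomial.natDegree_pow]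
  exact dvd_mul_right _ _

/-- On the line `y = 0` the polynomial `P₁ - lam * P₂` has degree `5`. -/
theorem natDegree_restrict_horizontal {lam : ℂ} (h : lam ≠ 1) :
    (aeval ![Polynomial.X, 0] (P₁ - C lam * P₂) : Polynomial ℂ).natDegree = 5 := by
  set s : ℂ := (Real.sqrt 5 : ℂ)
  have hF : (aeval ![Polynomial.X, 0] (P₁ - C lam * P₂) : Polynomial ℂ) =
      Polynomial.C ((1 - lam) * (2 / 5)) * Polynomial.X ^ 5
      + Polynomial.C ((1 + s) / 2 - lam * ((1 - s) / 2)) * Polynomial.X ^ 4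
      + Polynomial.C (lam * (2 - s) - (2 + s)) * Polynomial.X ^ 2
      + Polynomial.C ((11 + 5 * s) / 10 - lam * ((11 - 5 * s) / 10)) := by
    simp only [P₁, P₂, map_add, map_sub, map_mul, map_pow, aeval_X, aeval_C,
      Polynomial.algebraMap_eq, Matrix.cons_val_zero, Matrix.cons_val_one, map_one]
    ring
  rw [hF]
  compute_degree!
  exact sub_ne_zero.2 h.symm

/-- On a suitable vertical line the polynomial `P₁ - lam * P₂` has degree `4`. -/
theorem exists_natDegree_restrict_vertical {lam : ℂ} (h : lam ≠ 1) :
    ∃ a : ℂ, (aeval ![Polynomial.C a, Polynomial.X] (P₁ - C lam * P₂) :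
      Polynomial ℂ).natDegree = 4 := by
  set s : ℂ := (Real.sqrt 5 : ℂ)
  obtain ⟨a, ha⟩ : ∃ a : ℂ, (1 - lam) * 2 * a + ((1 + s) / 2 - lam * ((1 - s) / 2)) = 1 := by
    have h1 : 1 - lam ≠ 0 := sub_ne_zero.2 h.symm
    refine ⟨(1 - ((1 + s) / 2 - lam * ((1 - s) / 2))) / ((1 - lam) * 2), ?_⟩
    rw [mul_div_cancel₀ _ (mul_ne_zero h1 two_ne_zero), sub_add_cancel]
  refine ⟨a, ?_⟩
  have hF : (aeval ![Polynomial.C a, Polynomial.X] (P₁ - C lam * P₂) : Polynomial ℂ) =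
      Polynomial.C ((1 - lam) * 2 * a + ((1 + s) / 2 - lam * ((1 - s) / 2))) * Polynomial.X ^ 4
      + Polynomial.C ((lam - 1) * 4 * a ^ 3 + (1 + s - lam * (1 - s)) * a ^ 2
        + (lam * (2 - s) - (2 + s))) * Polynomial.X ^ 2
      + Polynomial.C ((1 - lam) * (2 / 5) * a ^ 5
        + ((1 + s) / 2 - lam * ((1 - s) / 2)) * a ^ 4 + (lam * (2 - s) - (2 + s)) * a ^ 2
        + ((11 + 5 * s) / 10 - lam * ((11 - 5 * s) / 10))) := by
    simp only [P₁, P₂, map_add, map_sub, map_mul, map_pow, aeval_X, aeval_C,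
      Polynomial.algebraMap_eq, Matrix.cons_val_zero, Matrix.cons_val_one, map_one]
    ring
  rw [hF, ha]
  compute_degree!

/-- For `λ ∈ ℂ*`, `λ ≠ 1`, the polynomial `P₁ − λ·P₂` is not a `d`-th power up to a
constant for any `d ≥ 2`: the fiber of `h = P₁/P₂` over `λ` is not multiple. -/
theorem no_multiple_fiber_away_from_one (lam : ℂ) (hlam0 : lam ≠ 0) (hlam1 : lam ≠ 1) :
    ¬ ∃ (g : MvPolynomial (Fin 2) ℂ) (u : ℂ) (d : ℕ),
        u ≠ 0 ∧ 2 ≤ d ∧ P₁ - C lam * P₂ = C u * g ^ d := by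
  rintro ⟨g, u, d, hu, hd, h⟩
  have h5 := dvd_natDegree_aeval_of_eq_C_mul_pow hu h ![Polynomial.X, 0]
  rw [natDegree_restrict_horizontal hlam1] at h5
  obtain ⟨a, ha⟩ := exists_natDegree_restrict_vertical hlam1
  have h4 := dvd_natDegree_aeval_of_eq_C_mul_pow hu h ![Polynomial.C a, Polynomial.X]
  rw [ha] at h4
  have h1 : d ∣ 1 := (Nat.dvd_add_right h4).1 h5
  exact absurd (Nat.le_of_dvd one_pos h1) (by lia)
end
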